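/- arXiv:1504.01166 — 2 statements merged into one kernel-verified Lean document; each statement's English description precedes it below -/
import Mathlib

section
/- (WKFI, equality part.) Under the hypotheses of the weighted Ky Fan inequality — φ: ℝ^d → [0,∞) measurable and positive on a nonempty open set, C₁, C₂ symmetric strictly positive definite, λ₁, λ₂ ∈ [0,1] with λ₁ + λ₂ = 1, C = λ₁C₁ + λ₂C₂, the integrals α_φ and Φ_φ absolutely convergent, and conditions λ₁α_φ(C₁) + λ₂α_φ(C₂) − α_φ(C) ≥ 0 and [λ₁α_φ(C₁) + λ₂α_φ(C₂) − α_φ(C)]·log[(2π)^d det C] + tr(C⁻¹(λ₁Φ_{φ,C₁} + λ₂Φ_{φ,C₂} − Φ_{φ,C})) ≤ 0 — equality σ_φ(C) = λ₁σ_φ(C₁) + λ₂σ_φ(C₂) holds if and only if λ₁λ₂ = 0 or C₁ = C₂. -/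
open Matrix Real MeasureTheory

/-- The centered Gaussian density with covariance matrix `C` on `ℝ^d`. -/
noncomputable def gaussDensity {d : ℕ} (C : Matrix (Fin d) (Fin d) ℝ)
    (x : Fin d → ℝ) : ℝ :=
  (2 * Real.pi) ^ (-(d : ℝ) / 2) * C.det ^ (-(1 : ℝ) / 2) *
    Real.exp (-(1 / 2) * (x ⬝ᵥ C⁻¹ *ᵥ x))

/-- `α_φ(C) = ∫ φ(x) f_C(x) dx`. -/
noncomputable def wAlpha {d : ℕ} (φ : (Fin d → ℝ) → ℝ)
    (C : Matrix (Fin d) (Fin d) ℝ) : ℝ :=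
  ∫ x : Fin d → ℝ, φ x * gaussDensity C x

/-- `Φ_{φ,C} = ∫ x xᵀ φ(x) f_C(x) dx` (entrywise). -/
noncomputable def wPhi {d : ℕ} (φ : (Fin d → ℝ) → ℝ)
    (C : Matrix (Fin d) (Fin d) ℝ) : Matrix (Fin d) (Fin d) ℝ :=
  Matrix.of fun i j : Fin d => ∫ x : Fin d → ℝ, x i * x j * φ x * gaussDensity C x

/-- `σ_φ(C) = (α_φ(C)/2)·log[(2π)^d det C] + ½ tr(C⁻¹ Φ_{φ,C})`. -/
noncomputable def wSigma {d : ℕ} (φ : (Fin d → ℝ) → ℝ)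
    (C : Matrix (Fin d) (Fin d) ℝ) : ℝ :=
  (wAlpha φ C / 2) * Real.log ((2 * Real.pi) ^ d * C.det) +
    (1 / 2) * (C⁻¹ * wPhi φ C).trace

lemma gaussDensity_pos {d : ℕ} {C : Matrix (Fin d) (Fin d) ℝ} (hC : C.PosDef)
    (x : Fin d → ℝ) : 0 < gaussDensity C x := by
  have := hC.det_pos
  unfold gaussDensity
  positivity

lemma continuous_gaussDensity {d : ℕ} (C : Matrix (Fin d) (Fin d) ℝ) :
    Continuous (gaussDensity C) := by
  unfold gaussDensity
  fun_prop

lemma log_gaussDensity {d : ℕ} {C : Matrix (Fin d) (Fin d) ℝ} (hC : C.PosDef)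
    (x : Fin d → ℝ) :
    Real.log (gaussDensity C x) =
      -(1 / 2) * Real.log ((2 * Real.pi) ^ d * C.det) - (1 / 2) * (x ⬝ᵥ C⁻¹ *ᵥ x) := by
  have hdet := hC.det_pos
  have hpi : (0 : ℝ) < 2 * Real.pi := by positivity
  unfold gaussDensity
  rw [Real.log_mul (by positivity) (by positivity), Real.log_mul (by positivity) (by positivity),
    Real.log_exp, Real.log_rpow hpi, Real.log_rpow hdet,
    Real.log_mul (pow_pos hpi d).ne' hdet.ne', Real.log_pow]
  ring

/-- The weighted integral of a quadratic form is the trace of its matrix against `wPhi`. -/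
lemma integral_quadratic_mul_gaussDensity {d : ℕ} {φ : (Fin d → ℝ) → ℝ}
    {A : Matrix (Fin d) (Fin d) ℝ} (M : Matrix (Fin d) (Fin d) ℝ)
    (hΦ : ∀ i j : Fin d,
      Integrable (fun x : Fin d → ℝ => x i * x j * φ x * gaussDensity A x)) :
    Integrable (fun x : Fin d → ℝ => φ x * gaussDensity A x * (x ⬝ᵥ M *ᵥ x)) ∧
      ∫ x : Fin d → ℝ, φ x * gaussDensity A x * (x ⬝ᵥ M *ᵥ x) = (M * wPhi φ A).trace := by
  have hint : ∀ i j : Fin d,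
      Integrable (fun x : Fin d → ℝ => M i j * (x j * x i * φ x * gaussDensity A x)) :=
    fun i j => (hΦ j i).const_mul _
  have hexp : (fun x : Fin d → ℝ => φ x * gaussDensity A x * (x ⬝ᵥ M *ᵥ x)) =
      fun x => ∑ i, ∑ j, M i j * (x j * x i * φ x * gaussDensity A x) := by
    ext x
    simp only [dotProduct, mulVec, Finset.mul_sum]
    refine Finset.sum_congr rfl fun i _ => Finset.sum_congr rfl fun j _ => ?_
    ring
  rw [hexp]
  refine ⟨integrable_finsetSum _ fun i _ => integrable_finsetSum _ fun j _ => hint i j, ?_⟩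
  rw [integral_finsetSum _ fun i _ => integrable_finsetSum _ fun j _ => hint i j]
  simp only [Matrix.trace, Matrix.diag, Matrix.mul_apply, wPhi, Matrix.of_apply]
  refine Finset.sum_congr rfl fun i _ => ?_
  rw [integral_finsetSum _ fun j _ => hint i j]
  exact Finset.sum_congr rfl fun j _ => integral_const_mul _ _

/-- The weighted cross entropy of two centered Gaussian densities. -/
lemma integral_mul_log_gaussDensity {d : ℕ} {φ : (Fin d → ℝ) → ℝ}
    {A C : Matrix (Fin d) (Fin d) ℝ} (hC : C.PosDef)
    (hα : Integrable (fun x : Fin d → ℝ => φ x * gaussDensity A x))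
    (hΦ : ∀ i j : Fin d,
      Integrable (fun x : Fin d → ℝ => x i * x j * φ x * gaussDensity A x)) :
    Integrable (fun x : Fin d → ℝ => φ x * gaussDensity A x * Real.log (gaussDensity C x)) ∧
      ∫ x : Fin d → ℝ, φ x * gaussDensity A x * Real.log (gaussDensity C x) =
        -((wAlpha φ A / 2) * Real.log ((2 * Real.pi) ^ d * C.det) +
          (1 / 2) * (C⁻¹ * wPhi φ A).trace) := by
  obtain ⟨hq, hqv⟩ := integral_quadratic_mul_gaussDensity C⁻¹ hΦ
  have h₁ := hα.const_mul (-(1 / 2) * Real.log ((2 * Real.pi) ^ d * C.det))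
  have h₂ := hq.const_mul (1 / 2)
  have hexp : (fun x : Fin d → ℝ => φ x * gaussDensity A x * Real.log (gaussDensity C x)) =
      fun x => -(1 / 2) * Real.log ((2 * Real.pi) ^ d * C.det) * (φ x * gaussDensity A x) -
        1 / 2 * (φ x * gaussDensity A x * (x ⬝ᵥ C⁻¹ *ᵥ x)) := by
    ext x
    rw [log_gaussDensity hC]
    ring
  rw [hexp]
  refine ⟨h₁.sub h₂, ?_⟩
  rw [integral_sub h₁ h₂, integral_const_mul, integral_const_mul, hqv, wAlpha]
  ring

lemma sub_lt_mul_log_sub_log {a b : ℝ} (ha : 0 < a) (hb : 0 < b) (hab : a ≠ b) :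
    a - b < a * (Real.log a - Real.log b) := by
  have h := Real.log_lt_sub_one_of_pos (div_pos hb ha) (by
    rw [ne_eq, div_eq_one_iff_eq ha.ne']
    exact hab.symm)
  rw [Real.log_div hb.ne' ha.ne'] at h
  have h' := mul_lt_mul_of_pos_left h ha
  have : a * (b / a - 1) = b - a := by field_simp
  linarith

lemma sub_le_mul_log_sub_log {a b : ℝ} (ha : 0 < a) (hb : 0 < b) :
    a - b ≤ a * (Real.log a - Real.log b) := by
  rcases eq_or_ne a b with rfl | hab
  · simp
  · exact (sub_lt_mul_log_sub_log ha hb hab).le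

/-- The integrand of the weighted Kullback–Leibler divergence of two Gaussian densities,
corrected by the difference of the densities so that it is pointwise nonnegative. -/
noncomputable def gaussDivergence {d : ℕ} (φ : (Fin d → ℝ) → ℝ)
    (A C : Matrix (Fin d) (Fin d) ℝ) (x : Fin d → ℝ) : ℝ :=
  φ x * (gaussDensity A x * (Real.log (gaussDensity A x) - Real.log (gaussDensity C x)) -
    (gaussDensity A x - gaussDensity C x))

lemma gaussDivergence_nonneg {d : ℕ} {φ : (Fin d → ℝ) → ℝ} (hφ : ∀ x, 0 ≤ φ x)
    {A C : Matrix (Fin d) (Fin d) ℝ} (hA : A.PosDef) (hC : C.PosDef) (x : Fin d → ℝ) :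
    0 ≤ gaussDivergence φ A C x :=
  mul_nonneg (hφ x) (sub_nonneg.2
    (sub_le_mul_log_sub_log (gaussDensity_pos hA x) (gaussDensity_pos hC x)))

lemma integral_gaussDivergence {d : ℕ} {φ : (Fin d → ℝ) → ℝ}
    {A C : Matrix (Fin d) (Fin d) ℝ} (hA : A.PosDef) (hC : C.PosDef)
    (hαA : Integrable (fun x : Fin d → ℝ => φ x * gaussDensity A x))
    (hαC : Integrable (fun x : Fin d → ℝ => φ x * gaussDensity C x))
    (hΦA : ∀ i j : Fin d,
      Integrable (fun x : Fin d → ℝ => x i * x j * φ x * gaussDensity A x)) :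
    Integrable (gaussDivergence φ A C) ∧
      ∫ x, gaussDivergence φ A C x =
        (wAlpha φ A / 2) * Real.log ((2 * Real.pi) ^ d * C.det) +
          (1 / 2) * (C⁻¹ * wPhi φ A).trace - wSigma φ A - (wAlpha φ A - wAlpha φ C) := by
  obtain ⟨h₁, hv₁⟩ := integral_mul_log_gaussDensity hA hαA hΦA
  obtain ⟨h₂, hv₂⟩ := integral_mul_log_gaussDensity hC hαA hΦA
  have hexp : gaussDivergence φ A C = fun x =>
      (φ x * gaussDensity A x * Real.log (gaussDensity A x) -
        φ x * gaussDensity A x * Real.log (gaussDensity C x)) -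
      (φ x * gaussDensity A x - φ x * gaussDensity C x) := by
    ext x
    unfold gaussDivergence
    ring
  rw [hexp]
  refine ⟨(h₁.sub h₂).sub (hαA.sub hαC), ?_⟩
  refine (integral_sub (h₁.sub h₂) (hαA.sub hαC)).trans ?_
  simp only [Pi.sub_apply]
  rw [integral_sub h₁ h₂, integral_sub hαA hαC, hv₁, hv₂, wSigma, wAlpha, wAlpha]
  ring

/-- A symmetric matrix whose quadratic form is constant on a nonempty open set vanishes. -/
lemma eq_zero_of_quadratic_const_on_open {d : ℕ} {M : Matrix (Fin d) (Fin d) ℝ}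
    (hM : M.IsSymm) {U : Set (Fin d → ℝ)} (hU : IsOpen U) (hne : U.Nonempty) {c : ℝ}
    (hc : ∀ x ∈ U, x ⬝ᵥ M *ᵥ x = c) : M = 0 := by
  obtain ⟨x₀, hx₀⟩ := hne
  have hquad : ∀ v : Fin d → ℝ, v ⬝ᵥ M *ᵥ v = 0 := by
    intro v
    have hcont : Continuous fun t : ℝ => (x₀ + t • v, x₀ - t • v) := by fun_prop
    have hmem : ∀ᶠ t in nhds (0 : ℝ), (x₀ + t • v, x₀ - t • v) ∈ U ×ˢ U :=
      hcont.continuousAt.eventually_mem ((hU.prod hU).mem_nhds (by simp [hx₀]))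
    obtain ⟨t, ht, ht0⟩ := ((hmem.filter_mono nhdsWithin_le_nhds).and
      (self_mem_nhdsWithin (s := Set.Ioi (0 : ℝ)))).exists
    have h₁ := hc _ ht.1
    have h₂ := hc _ ht.2
    have h₀ := hc _ hx₀
    simp only [mulVec_add, mulVec_sub, mulVec_smul, dotProduct_add, dotProduct_sub,
      add_dotProduct, sub_dotProduct, smul_dotProduct, dotProduct_smul, smul_eq_mul] at h₁ h₂
    have hmul : t ^ 2 * (v ⬝ᵥ M *ᵥ v) = 0 := by linarith
    exact (mul_eq_zero.1 hmul).resolve_left (pow_ne_zero _ (ne_of_gt ht0))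
  ext i j
  have hi := hquad (Pi.single i 1)
  have hj := hquad (Pi.single j 1)
  have hij := hquad (Pi.single i 1 + Pi.single j 1)
  simp only [mulVec_add, dotProduct_add, add_dotProduct, mulVec_single_one,
    single_one_dotProduct, Matrix.col_apply] at hi hj hij
  have := hM.apply i j
  simp only [Matrix.zero_apply]
  linarith

/-- A Gaussian covariance is determined by the density on any nonempty open set. -/
lemma eq_of_gaussDensity_eqOn_open {d : ℕ} {A C : Matrix (Fin d) (Fin d) ℝ}
    (hA : A.PosDef) (hC : C.PosDef) {U : Set (Fin d → ℝ)} (hU : IsOpen U) (hne : U.Nonempty)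
    (h : Set.EqOn (gaussDensity A) (gaussDensity C) U) : A = C := by
  have hsymm : (A⁻¹ - C⁻¹).IsSymm := by
    have hA' : A⁻¹.IsSymm := by simpa [IsHermitian, IsSymm] using hA.inv.isHermitian
    have hC' : C⁻¹.IsSymm := by simpa [IsHermitian, IsSymm] using hC.inv.isHermitian
    exact hA'.sub hC'
  have hinv : A⁻¹ - C⁻¹ = 0 := by
    refine eq_zero_of_quadratic_const_on_open hsymm hU hne
      (c := Real.log ((2 * Real.pi) ^ d * C.det) - Real.log ((2 * Real.pi) ^ d * A.det))
      fun x hx => ?_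
    have hlog := congrArg Real.log (h hx)
    rw [log_gaussDensity hA, log_gaussDensity hC] at hlog
    rw [sub_mulVec, dotProduct_sub]
    linarith
  exact Matrix.inv_inj (sub_eq_zero.1 hinv) ((Matrix.isUnit_iff_isUnit_det _).1 hA.isUnit)

/-- The weighted divergence integral vanishes only for equal covariances. -/
lemma eq_of_integral_gaussDivergence_eq_zero {d : ℕ} {φ : (Fin d → ℝ) → ℝ}
    (hφ : ∀ x, 0 ≤ φ x)
    (hφpos : ∃ U : Set (Fin d → ℝ), IsOpen U ∧ U.Nonempty ∧ ∀ x ∈ U, 0 < φ x)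
    {A C : Matrix (Fin d) (Fin d) ℝ} (hA : A.PosDef) (hC : C.PosDef)
    (hint : Integrable (gaussDivergence φ A C))
    (hzero : ∫ x, gaussDivergence φ A C x = 0) : A = C := by
  obtain ⟨U, hU, hne, hUpos⟩ := hφpos
  refine eq_of_gaussDensity_eqOn_open hA hC hU hne ?_
  rw [integral_eq_zero_iff_of_nonneg (gaussDivergence_nonneg hφ hA hC) hint] at hzero
  have hopen : IsOpen (U ∩ {x | gaussDensity A x ≠ gaussDensity C x}) :=
    hU.inter (isOpen_ne_fun (continuous_gaussDensity A) (continuous_gaussDensity C))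
  have hnull : volume (U ∩ {x | gaussDensity A x ≠ gaussDensity C x}) = 0 := by
    refine measure_mono_null (fun x hx => ?_) (ae_iff.1 hzero)
    exact (mul_pos (hUpos x hx.1) (sub_pos.2 (sub_lt_mul_log_sub_log
      (gaussDensity_pos hA x) (gaussDensity_pos hC x) hx.2))).ne'
  have hempty := (hopen.measure_eq_zero_iff volume).1 hnull
  intro x hx
  by_contra hxne
  exact Set.eq_empty_iff_forall_notMem.1 hempty x ⟨hx, hxne⟩

/-- **Weighted Ky Fan inequality** (equality part). -/
theorem weighted_ky_fan_equality_iff {d : ℕ} (φ : (Fin d → ℝ) → ℝ)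
    (hφmeas : Measurable φ) (hφnonneg : ∀ x, 0 ≤ φ x)
    (hφpos : ∃ U : Set (Fin d → ℝ), IsOpen U ∧ U.Nonempty ∧ ∀ x ∈ U, 0 < φ x)
    (C₁ C₂ : Matrix (Fin d) (Fin d) ℝ) (hC₁ : C₁.PosDef) (hC₂ : C₂.PosDef)
    (l₁ l₂ : ℝ) (hl₁ : l₁ ∈ Set.Icc (0 : ℝ) 1) (hl₂ : l₂ ∈ Set.Icc (0 : ℝ) 1)
    (hsum : l₁ + l₂ = 1)
    (hα₁ : Integrable (fun x : Fin d → ℝ => φ x * gaussDensity C₁ x))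
    (hα₂ : Integrable (fun x : Fin d → ℝ => φ x * gaussDensity C₂ x))
    (hα : Integrable (fun x : Fin d → ℝ => φ x * gaussDensity (l₁ • C₁ + l₂ • C₂) x))
    (hΦ₁ : ∀ i j : Fin d,
      Integrable (fun x : Fin d → ℝ => x i * x j * φ x * gaussDensity C₁ x))
    (hΦ₂ : ∀ i j : Fin d,
      Integrable (fun x : Fin d → ℝ => x i * x j * φ x * gaussDensity C₂ x))
    (hΦ : ∀ i j : Fin d,
      Integrable (fun x : Fin d → ℝ =>
        x i * x j * φ x * gaussDensity (l₁ • C₁ + l₂ • C₂) x))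
    (hcond₁ : 0 ≤ l₁ * wAlpha φ C₁ + l₂ * wAlpha φ C₂ - wAlpha φ (l₁ • C₁ + l₂ • C₂))
    (hcond₂ :
      (l₁ * wAlpha φ C₁ + l₂ * wAlpha φ C₂ - wAlpha φ (l₁ • C₁ + l₂ • C₂)) *
          Real.log ((2 * Real.pi) ^ d * (l₁ • C₁ + l₂ • C₂).det) +
        ((l₁ • C₁ + l₂ • C₂)⁻¹ *
          (l₁ • wPhi φ C₁ + l₂ • wPhi φ C₂ - wPhi φ (l₁ • C₁ + l₂ • C₂))).trace ≤ 0) :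
    wSigma φ (l₁ • C₁ + l₂ • C₂) = l₁ * wSigma φ C₁ + l₂ * wSigma φ C₂ ↔
      l₁ * l₂ = 0 ∨ C₁ = C₂ := by
  constructor
  · intro heq
    refine or_iff_not_imp_left.2 fun hne => ?_
    have hl₁pos : 0 < l₁ := lt_of_le_of_ne hl₁.1 (Ne.symm (left_ne_zero_of_mul hne))
    have hl₂pos : 0 < l₂ := lt_of_le_of_ne hl₂.1 (Ne.symm (right_ne_zero_of_mul hne))
    have hC : (l₁ • C₁ + l₂ • C₂).PosDef := (hC₁.smul hl₁pos).add (hC₂.smul hl₂pos)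
    obtain ⟨hD₁, hv₁⟩ := integral_gaussDivergence hC₁ hC hα₁ hα hΦ₁
    obtain ⟨hD₂, hv₂⟩ := integral_gaussDivergence hC₂ hC hα₂ hα hΦ₂
    have hn₁ : 0 ≤ ∫ x, gaussDivergence φ C₁ (l₁ • C₁ + l₂ • C₂) x :=
      integral_nonneg fun x => gaussDivergence_nonneg hφnonneg hC₁ hC x
    have hn₂ : 0 ≤ ∫ x, gaussDivergence φ C₂ (l₁ • C₁ + l₂ • C₂) x :=
      integral_nonneg fun x => gaussDivergence_nonneg hφnonneg hC₂ hC x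
    have hzero : ∫ x, gaussDivergence φ C₁ (l₁ • C₁ + l₂ • C₂) x = 0 := by
      have hσ : wSigma φ (l₁ • C₁ + l₂ • C₂) = wAlpha φ (l₁ • C₁ + l₂ • C₂) / 2 *
          Real.log ((2 * Real.pi) ^ d * (l₁ • C₁ + l₂ • C₂).det) +
          1 / 2 * ((l₁ • C₁ + l₂ • C₂)⁻¹ * wPhi φ (l₁ • C₁ + l₂ • C₂)).trace := rfl
      rw [Matrix.mul_sub, Matrix.mul_add, Matrix.mul_smul, Matrix.mul_smul, Matrix.trace_sub,
        Matrix.trace_add, Matrix.trace_smul, Matrix.trace_smul, smul_eq_mul, smul_eq_mul]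
        at hcond₂
      generalize l₁ • C₁ + l₂ • C₂ = C at *
      have hm₁ := congrArg (l₁ * ·) hv₁
      have hm₂ := congrArg (l₂ * ·) hv₂
      have hl : l₂ * wAlpha φ C = wAlpha φ C - l₁ * wAlpha φ C := by
        linear_combination wAlpha φ C * hsum
      have hp₁ := mul_nonneg hl₁.1 hn₁
      have hp₂ := mul_nonneg hl₂.1 hn₂
      have : l₁ * ∫ x, gaussDivergence φ C₁ C x = 0 := by
        ring_nf at hm₁ hm₂ hp₁ hp₂ hcond₁ hcond₂ hσ heq hl ⊢
        linarith
      exact (mul_eq_zero.1 this).resolve_left hl₁pos.ne'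
    have h := eq_of_integral_gaussDivergence_eq_zero hφnonneg hφpos hC₁ hC hD₁ hzero
    have hsmul : l₂ • C₁ = l₂ • C₂ := by
      have hsplit : C₁ = l₁ • C₁ + l₂ • C₁ := by rw [← add_smul, hsum, one_smul]
      exact add_left_cancel (hsplit.symm.trans h)
    exact smul_right_injective _ hl₂pos.ne' hsmul
  · rintro (h | rfl)
    · rcases mul_eq_zero.1 h with rfl | rfl
      · obtain rfl : l₂ = 1 := by linarith
        simp
      · obtain rfl : l₁ = 1 := by linarith
        simp
    · rw [← add_smul, ← add_mul, hsum, one_smul, one_mul]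
end

section
/- (Exponentially weighted Ky Fan inequality, inequality part.) Let C₁, C₂ be symmetric strictly positive definite d×d real matrices, λ₁, λ₂ ∈ [0,1] with λ₁ + λ₂ = 1, and C = λ₁C₁ + λ₂C₂. If t ∈ S (i.e. F^{(1)}(t) ≥ 0 and F^{(2)}(t) ≤ 0), then ½ log[(2πe)^d det C]·exp(½tᵀCt) − λ₁·½ log[(2πe)^d det C₁]·exp(½tᵀC₁t) − λ₂·½ log[(2πe)^d det C₂]·exp(½tᵀC₂t) ≥ 0. -/
open Matrix Real

/-- `F⁽¹⁾(t) = Σ_a λ_a exp(½tᵀC_a t) − exp(½tᵀCt)` with `C = λ₁C₁ + λ₂C₂`. -/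
noncomputable def F1 {d : ℕ} (C₁ C₂ : Matrix (Fin d) (Fin d) ℝ) (l₁ l₂ : ℝ)
    (t : Fin d → ℝ) : ℝ :=
  l₁ * Real.exp ((1 / 2) * (t ⬝ᵥ C₁ *ᵥ t)) +
    l₂ * Real.exp ((1 / 2) * (t ⬝ᵥ C₂ *ᵥ t)) -
    Real.exp ((1 / 2) * (t ⬝ᵥ (l₁ • C₁ + l₂ • C₂) *ᵥ t))

/-- `F⁽²⁾(t) = F⁽¹⁾(t)·log[(2π)^d det C] + Σ_a λ_a exp(½tᵀC_a t)·tr(C⁻¹C_a)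
− d·exp(½tᵀCt)` with `C = λ₁C₁ + λ₂C₂`. -/
noncomputable def F2 {d : ℕ} (C₁ C₂ : Matrix (Fin d) (Fin d) ℝ) (l₁ l₂ : ℝ)
    (t : Fin d → ℝ) : ℝ :=
  F1 C₁ C₂ l₁ l₂ t * Real.log ((2 * Real.pi) ^ d * (l₁ • C₁ + l₂ • C₂).det) +
    l₁ * Real.exp ((1 / 2) * (t ⬝ᵥ C₁ *ᵥ t)) * ((l₁ • C₁ + l₂ • C₂)⁻¹ * C₁).trace +
    l₂ * Real.exp ((1 / 2) * (t ⬝ᵥ C₂ *ᵥ t)) * ((l₁ • C₁ + l₂ • C₂)⁻¹ * C₂).trace -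
    d * Real.exp ((1 / 2) * (t ⬝ᵥ (l₁ • C₁ + l₂ • C₂) *ᵥ t))

open scoped MatrixOrder in
theorem Matrix.PosDef.exists_isUnit_eq_conjTranspose_mul_self {n : Type*} [Fintype n]
    [DecidableEq n] {A : Matrix n n ℝ} (hA : A.PosDef) :
    ∃ B : Matrix n n ℝ, IsUnit B ∧ A = Bᴴ * B :=
  CStarAlgebra.isStrictlyPositive_iff_eq_star_mul_self.mp hA.isStrictlyPositive

theorem Matrix.PosDef.log_det_le_trace_sub_card {n : Type*} [Fintype n] [DecidableEq n]
    {A : Matrix n n ℝ} (hA : A.PosDef) :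
    Real.log A.det ≤ A.trace - Fintype.card n := by
  have hdet := hA.isHermitian.det_eq_prod_eigenvalues
  have htr := hA.isHermitian.trace_eq_sum_eigenvalues
  simp only [RCLike.ofReal_real_eq_id, id_eq] at hdet htr
  rw [hdet, htr, Real.log_prod fun i _ => (hA.eigenvalues_pos i).ne']
  calc ∑ i, Real.log (hA.isHermitian.eigenvalues i)
      ≤ ∑ i, (hA.isHermitian.eigenvalues i - 1) :=
        Finset.sum_le_sum fun i _ => Real.log_le_sub_one_of_pos (hA.eigenvalues_pos i)
    _ = _ := by simp [Finset.sum_sub_distrib]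

/-- The tangent-plane inequality for the concave function `log det` on positive definite
matrices. -/
theorem Matrix.PosDef.log_det_le_log_det_add_trace {n : Type*} [Fintype n] [DecidableEq n]
    {A C : Matrix n n ℝ} (hA : A.PosDef) (hC : C.PosDef) :
    Real.log A.det ≤ Real.log C.det + (C⁻¹ * A).trace - Fintype.card n := by
  obtain ⟨B, hB, hCB⟩ := hC.inv.exists_isUnit_eq_conjTranspose_mul_self
  have hM : (B * A * Bᴴ).PosDef :=
    hA.mul_mul_conjTranspose_same (Matrix.vecMul_injective_of_isUnit hB)
  have htr : (B * A * Bᴴ).trace = (C⁻¹ * A).trace := by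
    rw [Matrix.trace_mul_comm, ← Matrix.mul_assoc, ← hCB]
  have hdet : (B * A * Bᴴ).det = C.det⁻¹ * A.det := by
    rw [← Ring.inverse_eq_inv', ← Matrix.det_nonsing_inv, hCB, Matrix.det_mul, Matrix.det_mul,
      Matrix.det_mul]
    ring
  have h := hM.log_det_le_trace_sub_card
  rw [htr, hdet, Real.log_mul (inv_ne_zero hC.det_pos.ne') hA.det_pos.ne', Real.log_inv] at h
  linarith

theorem Matrix.PosDef.convex_combination {n : Type*} {A B : Matrix n n ℝ}
    (hA : A.PosDef) (hB : B.PosDef) {a b : ℝ} (ha : 0 ≤ a) (hb : 0 ≤ b) (hab : a + b = 1) :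
    (a • A + b • B).PosDef := by
  rcases ha.eq_or_lt with rfl | ha
  · obtain rfl : b = 1 := by linarith
    simpa using hB
  · exact (hA.smul ha).add_posSemidef (hB.posSemidef.smul hb)

/-- **Exponentially weighted Ky Fan inequality** (inequality part). -/
theorem exp_weighted_ky_fan_inequality {d : ℕ}
    (C₁ C₂ : Matrix (Fin d) (Fin d) ℝ) (hC₁ : C₁.PosDef) (hC₂ : C₂.PosDef)
    (l₁ l₂ : ℝ) (hl₁ : l₁ ∈ Set.Icc (0 : ℝ) 1) (hl₂ : l₂ ∈ Set.Icc (0 : ℝ) 1)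
    (hsum : l₁ + l₂ = 1) (t : Fin d → ℝ)
    (hF1 : 0 ≤ F1 C₁ C₂ l₁ l₂ t) (hF2 : F2 C₁ C₂ l₁ l₂ t ≤ 0) :
    0 ≤ (1 / 2) * Real.log ((2 * Real.pi * Real.exp 1) ^ d * (l₁ • C₁ + l₂ • C₂).det) *
          Real.exp ((1 / 2) * (t ⬝ᵥ (l₁ • C₁ + l₂ • C₂) *ᵥ t)) -
        l₁ * ((1 / 2) * Real.log ((2 * Real.pi * Real.exp 1) ^ d * C₁.det)) *
          Real.exp ((1 / 2) * (t ⬝ᵥ C₁ *ᵥ t)) -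
        l₂ * ((1 / 2) * Real.log ((2 * Real.pi * Real.exp 1) ^ d * C₂.det)) *
          Real.exp ((1 / 2) * (t ⬝ᵥ C₂ *ᵥ t)) := by
  have hC := hC₁.convex_combination hC₂ hl₁.1 hl₂.1 hsum
  have h₁ := hC₁.log_det_le_log_det_add_trace hC
  have h₂ := hC₂.log_det_le_log_det_add_trace hC
  have hlog (D : ℝ) (hD : 0 < D) :
      Real.log ((2 * Real.pi * Real.exp 1) ^ d * D) =
        d * Real.log (2 * Real.pi) + d + Real.log D := by
    rw [Real.log_mul (by positivity) hD.ne', Real.log_pow,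
      Real.log_mul (by positivity) (by positivity), Real.log_exp]
    ring
  rw [F2, Real.log_mul (by positivity) hC.det_pos.ne', Real.log_pow, F1] at hF2
  rw [hlog _ hC.det_pos, hlog _ hC₁.det_pos, hlog _ hC₂.det_pos]
  rw [Fintype.card_fin] at h₁ h₂
  have k₁ := mul_le_mul_of_nonneg_left h₁
    (mul_nonneg hl₁.1 (Real.exp_nonneg ((1 / 2) * (t ⬝ᵥ C₁ *ᵥ t))))
  have k₂ := mul_le_mul_of_nonneg_left h₂
    (mul_nonneg hl₂.1 (Real.exp_nonneg ((1 / 2) * (t ⬝ᵥ C₂ *ᵥ t))))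
  linarith
end
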